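/- arXiv:1705.00788 — 2 statements merged into one kernel-verified Lean document; each statement's English description precedes it below -/
import Mathlib

section
/- Let M be a graded D-module over R = k[x_1,…,x_n] and let 0 ≤ i ≤ n be such that H^i_dR(M) is a finite-dimensional k-vector space. Then H^{n−i}_dR(DD(M)) is isomorphic as a k-vector space to the k-linear dual of H^i_dR(M); in particular dim_k H^{n−i}_dR(DD(M)) = dim_k H^i_dR(M). -/
/-!
Statement 1: For a graded D-module `M` over `R = k[x₁,…,xₙ]` and `0 ≤ i ≤ n` with
`H^i_dR(M)` finite dimensional, `H^{n-i}_dR(DD(M))` is `k`-dual to `H^i_dR(M)`.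
-/

open MvPolynomial
open scoped DirectSum

set_option maxHeartbeats 2000000
set_option synthInstance.maxHeartbeats 1000000

section deRham

variable {k : Type} [Field k] {n : ℕ} {M : Type} [AddCommGroup M] [Module k M]

/-- The `i`-th term of the de Rham complex of `M` (a concrete realization of
`M ⊗ Λ^i(k^n)`, with basis of `Λ^i(k^n)` indexed by the `i`-element subsets of `Fin n`;
trivial for `i < 0` or `i > n`). -/
abbrev drT (k : Type) [Field k] (n : ℕ) (M : Type) [AddCommGroup M] [Module k M] (i : ℤ) :
    Type :=
  {s : Finset (Fin n) // (s.card : ℤ) = i} → M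

/-- The de Rham differential `M ⊗ Λ^i(k^n) → M ⊗ Λ^{i+1}(k^n)`,
`m ⊗ ω ↦ Σ_j ∂_j(m) ⊗ (e_j ∧ ω)`, written in the basis indexed by subsets. -/
noncomputable def drD (pd : Fin n → Module.End k M) (i : ℤ) :
    drT k n M i →ₗ[k] drT k n M (i + 1) where
  toFun ω t := ∑ j ∈ t.1.attach,
    ((-1 : ℤ) ^ ((t.1.filter (fun a => a < j.1)).card)) •
      pd j.1 (ω ⟨t.1.erase j.1, by
        have hc := t.2
        have hpos : 0 < t.1.card := Finset.card_pos.mpr ⟨j.1, j.2⟩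
        rw [Finset.card_erase_of_mem j.2]
        omega⟩)
  map_add' ω ω' := by
    funext t
    simp only [Pi.add_apply, map_add, smul_add]
    rw [Finset.sum_add_distrib]
  map_smul' c ω := by
    funext t
    simp only [Pi.smul_apply, map_smul, RingHom.id_apply, Finset.smul_sum, smul_comm c]

/-- The boundaries in degree `i` of the de Rham complex: the image of the differential
coming from degree `i - 1`. -/
noncomputable def drBnd (pd : Fin n → Module.End k M) (i : ℤ) : Submodule k (drT k n M i) :=
  (show i - 1 + 1 = i by ring) ▸ LinearMap.range (drD pd (i - 1))

/-- The `i`-th de Rham cohomology of the D-module `(M, pd)`: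
(kernel of `d^i`) / (image of `d^{i-1}`). -/
abbrev drH (pd : Fin n → Module.End k M) (i : ℤ) : Type :=
  ↥(LinearMap.ker (drD pd i)) ⧸
    Submodule.comap (LinearMap.ker (drD pd i)).subtype (drBnd pd i)

end deRham

section MatlisDual

variable {k : Type} [Field k] {n : ℕ} {M : Type} [AddCommGroup M] [Module k M]

/-- The carrier of the graded Matlis dual `DD(M)`:
`DD(M)_l = Hom_k(M_{-l-n}, k)`. -/
abbrev DDcar (deg : ℤ → Submodule k M) (n : ℕ) : Type :=
  @DirectSum ℤ (fun l => Module.Dual k ↥(deg (-l - (n : ℤ))))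
    (fun l => (inferInstance :
      AddCommGroup (Module.Dual k ↥(deg (-l - (n : ℤ))))).toAddCommMonoid)

/-- The projection of `M` onto its degree-`l` component, coming from the internal
direct sum decomposition. -/
noncomputable def gproj (deg : ℤ → Submodule k M) (hint : DirectSum.IsInternal deg) (l : ℤ) :
    M →ₗ[k] ↥(deg l) :=
  (DirectSum.component k ℤ (fun j => ↥(deg j)) l).comp
    (LinearEquiv.ofBijective (DirectSum.coeLinearMap deg) hint).symm.toLinearMap

/-- The evaluation pairing between `DD(M)` and `M`: an element `λ` of `DD(M)`,
with components `λ_l : Hom_k(M_{-l-n}, k)`, gives the functional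
`m ↦ Σ_l λ_l(m_{-l-n})` on `M`.  This is injective, so it characterizes the
`D`-module structure of `DD(M)` uniquely. -/
noncomputable def gev (deg : ℤ → Submodule k M) (hint : DirectSum.IsInternal deg) :
    DDcar deg n →ₗ[k] Module.Dual k M :=
  DirectSum.toModule k ℤ (Module.Dual k M)
    (fun l => (gproj deg hint (-l - (n : ℤ))).dualMap)

end MatlisDual

section AbstractDuality

variable {k : Type} [Field k]
  {A₀ A₁ A₂ B₀ B₁ B₂ ι : Type}
  [AddCommGroup A₀] [Module k A₀] [AddCommGroup A₁] [Module k A₁] [AddCommGroup A₂] [Module k A₂]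
  [AddCommGroup B₀] [Module k B₀] [AddCommGroup B₁] [Module k B₁] [AddCommGroup B₂] [Module k B₂]
  [SemilatticeSup ι] [OrderBot ι]

/-- If every vector of `Z` is fixed by all large enough members of a directed family of
endomorphisms of the ambient space, then a finite dimensional quotient of `Z` is represented
by vectors fixed by a single member of the family. -/
theorem exists_index_fixed_representatives (P : ι → A₁ →ₗ[k] A₁)
    (hP : ∀ a, ∃ T₀, ∀ T, T₀ ≤ T → P T a = a) (Z : Submodule k A₁) (N : Submodule k Z)
    [FiniteDimensional k (Z ⧸ N)] :
    ∃ T, ∀ z : Z, ∃ z' : Z, P T z' = z' ∧ z - z' ∈ N := by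
  obtain ⟨S, hS⟩ := (Module.Finite.fg_top : (⊤ : Submodule k (Z ⧸ N)).FG)
  choose lift hlift using N.mkQ_surjective
  choose T₀ hT₀ using fun a : A₁ => hP a
  let T := S.sup fun x => T₀ (lift x)
  let W : Submodule k (Z ⧸ N) :=
    (LinearMap.ker ((P T - LinearMap.id) ∘ₗ Z.subtype)).map N.mkQ
  have hW : ⊤ ≤ W := by
    rw [← hS, Submodule.span_le]
    intro x hx
    refine ⟨lift x, ?_, hlift x⟩
    have : P T (lift x) = lift x :=
      hT₀ _ _ (Finset.le_sup (f := fun x => T₀ (lift x)) hx)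
    simp [this]
  refine ⟨T, fun z => ?_⟩
  obtain ⟨z', hz', he⟩ := hW (Submodule.mem_top (x := N.mkQ z))
  refine ⟨z', ?_, ?_⟩
  · simpa [sub_eq_zero] using hz'
  · rw [← Submodule.Quotient.eq]
    exact he.symm

/-- A bilinear pairing whose left kernel is `K`, and which represents exactly the functionals
vanishing on `L`, induces an isomorphism of a quotient with the dual of a quotient. -/
theorem nonempty_quotient_equiv_dual_quotient {Y Z : Type} [AddCommGroup Y] [Module k Y]
    [AddCommGroup Z] [Module k Z] (F : Y →ₗ[k] Module.Dual k Z) (K : Submodule k Y)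
    (L : Submodule k Z) (hK : LinearMap.ker F = K) (hL : LinearMap.range F = L.dualAnnihilator) :
    Nonempty ((Y ⧸ K) ≃ₗ[k] Module.Dual k (Z ⧸ L)) :=
  ⟨(Submodule.quotEquivOfEq _ _ hK.symm).trans
    (F.quotKerEquivRange.trans
      ((LinearEquiv.ofEq _ _ hL).trans L.dualQuotEquivDualAnnihilator.symm))⟩

/-- Two three-term complexes paired by injective maps onto the functionals of finite support
have dual cohomology, as soon as the cohomology of the first one is finite dimensional. -/
theorem nonempty_cohomology_equiv_dual
    (d₀ : A₀ →ₗ[k] A₁) (d₁ : A₁ →ₗ[k] A₂) (hd : ∀ a, d₁ (d₀ a) = 0)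
    (e₀ : B₀ →ₗ[k] B₁) (e₁ : B₁ →ₗ[k] B₂)
    (Φ₀ : B₂ →ₗ[k] Module.Dual k A₀) (Φ₁ : B₁ →ₗ[k] Module.Dual k A₁)
    (Φ₂ : B₀ →ₗ[k] Module.Dual k A₂)
    (hΦ₀ : Function.Injective Φ₀) (hΦ₁ : Function.Injective Φ₁)
    (hadj₁ : ∀ b a, Φ₁ (e₀ b) a = -Φ₂ b (d₁ a))
    (hadj₀ : ∀ b a, Φ₀ (e₁ b) a = -Φ₁ b (d₀ a))
    (P₀ : ι → A₀ →ₗ[k] A₀) (P₁ : ι → A₁ →ₗ[k] A₁) (P₂ : ι → A₂ →ₗ[k] A₂)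
    (hPd₀ : ∀ T a, P₁ T (d₀ a) = d₀ (P₀ T a))
    (hPd₁ : ∀ T a, P₂ T (d₁ a) = d₁ (P₁ T a))
    (hrep₁ : ∀ T (φ : Module.Dual k A₁), ∃ b, Φ₁ b = φ ∘ₗ P₁ T)
    (hrep₂ : ∀ T (φ : Module.Dual k A₂), ∃ b, Φ₂ b = φ ∘ₗ P₂ T)
    (hfix : ∀ b, ∃ T, Φ₁ b ∘ₗ P₁ T = Φ₁ b)
    (hexh : ∀ a, ∃ T₀, ∀ T, T₀ ≤ T → P₁ T a = a)
    (N : Submodule k A₁) (hN : N = LinearMap.range d₀)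
    (N' : Submodule k B₁) (hN' : N' = LinearMap.range e₀)
    [FiniteDimensional k
      (LinearMap.ker d₁ ⧸ Submodule.comap (LinearMap.ker d₁).subtype N)] :
    Nonempty ((LinearMap.ker e₁ ⧸ Submodule.comap (LinearMap.ker e₁).subtype N') ≃ₗ[k]
      Module.Dual k (LinearMap.ker d₁ ⧸ Submodule.comap (LinearMap.ker d₁).subtype N)) := by
  refine nonempty_quotient_equiv_dual_quotient
    (((LinearMap.ker d₁).subtype.dualMap ∘ₗ Φ₁) ∘ₗ (LinearMap.ker e₁).subtype) _ _ ?_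
    (le_antisymm ?_ ?_)
  · ext b
    constructor
    · intro hb
      have hb' : ∀ z ∈ LinearMap.ker d₁, Φ₁ b z = 0 := fun z hz =>
        LinearMap.congr_fun (LinearMap.mem_ker.mp hb) (⟨z, hz⟩ : LinearMap.ker d₁)
      have hmem : Φ₁ b ∈ LinearMap.range d₁.dualMap := by
        rw [LinearMap.range_dualMap_eq_dualAnnihilator_ker, Submodule.mem_dualAnnihilator]
        exact hb'
      obtain ⟨ψ, hψ⟩ := hmem
      obtain ⟨T, hT⟩ := hfix b
      obtain ⟨c, hc⟩ := hrep₂ T ψ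
      rw [Submodule.mem_comap, hN']
      refine ⟨-c, hΦ₁ (LinearMap.ext fun a => ?_)⟩
      rw [hadj₁, map_neg, LinearMap.neg_apply, neg_neg, hc, LinearMap.comp_apply, hPd₁,
        Submodule.subtype_apply, ← hT, LinearMap.comp_apply, ← hψ, LinearMap.dualMap_apply]
    · intro hb
      rw [Submodule.mem_comap, hN'] at hb
      obtain ⟨c, hc⟩ := hb
      refine LinearMap.mem_ker.mpr (LinearMap.ext fun z => ?_)
      change Φ₁ ((LinearMap.ker e₁).subtype b) z = 0
      have hz : d₁ z = 0 := z.2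
      rw [← hc, hadj₁, hz, map_zero, neg_zero]
  · rintro _ ⟨b, rfl⟩
    rw [Submodule.mem_dualAnnihilator]
    intro z hz
    rw [Submodule.mem_comap, hN] at hz
    obtain ⟨a, ha⟩ := hz
    have hb : e₁ b = 0 := b.2
    have h := hadj₀ b a
    rw [hb, map_zero, LinearMap.zero_apply, ha] at h
    exact neg_eq_zero.mp h.symm
  · intro φ hφ
    rw [Submodule.mem_dualAnnihilator] at hφ
    obtain ⟨T, hT⟩ := exists_index_fixed_representatives P₁ hexh (LinearMap.ker d₁)
      (Submodule.comap (LinearMap.ker d₁).subtype N)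
    obtain ⟨φ', hφ'⟩ := LinearMap.exists_extend φ
    have hext (z : LinearMap.ker d₁) : φ' z = φ z := LinearMap.congr_fun hφ' z
    have hbnd (a : A₀) : φ' (d₀ a) = 0 := by
      rw [hext ⟨d₀ a, hd a⟩]
      refine hφ _ ?_
      rw [Submodule.mem_comap, hN]
      exact ⟨a, rfl⟩
    obtain ⟨b, hb⟩ := hrep₁ T φ'
    have hbZ : b ∈ LinearMap.ker e₁ := by
      refine LinearMap.mem_ker.mpr (hΦ₀ (LinearMap.ext fun a => ?_))
      rw [hadj₀, hb, LinearMap.comp_apply, hPd₀, hbnd, neg_zero, map_zero,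
        LinearMap.zero_apply]
    refine ⟨⟨b, hbZ⟩, LinearMap.ext fun z => ?_⟩
    change Φ₁ b z = φ z
    obtain ⟨z', hz', hzz'⟩ := hT z
    rw [Submodule.mem_comap, hN] at hzz'
    obtain ⟨a, ha⟩ := hzz'
    have hz : (z : A₁) = z' + d₀ a := by
      rw [ha, map_sub, Submodule.subtype_apply, Submodule.subtype_apply, add_sub_cancel]
    rw [hb, LinearMap.comp_apply, ← hext, hz, map_add, map_add, map_add, hPd₀, hbnd, hbnd, hz']

end AbstractDuality

section Differential

variable {k : Type} [Field k] {n : ℕ} {M N : Type} [AddCommGroup M] [Module k M]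
  [AddCommGroup N] [Module k N]

/-- The total space of the de Rham complex, `M ⊗ Λ(k^n)`, with its differential. -/
noncomputable def totalD (pd : Fin n → Module.End k M) (ω : Finset (Fin n) → M)
    (t : Finset (Fin n)) : M :=
  ∑ j ∈ t, (-1 : ℤ) ^ (t.filter (fun a => a < j)).card • pd j (ω (t.erase j))

/-- The inclusion of the `i`-th term of the de Rham complex into the total space. -/
noncomputable def toTotal (i : ℤ) : drT k n M i →ₗ[k] (Finset (Fin n) → M) where
  toFun ω s := if h : (s.card : ℤ) = i then ω ⟨s, h⟩ else 0
  map_add' ω ω' := by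
    funext s
    by_cases h : (s.card : ℤ) = i <;> simp [h]
  map_smul' c ω := by
    funext s
    by_cases h : (s.card : ℤ) = i <;> simp [h]

theorem toTotal_coe (i : ℤ) (ω : drT k n M i) (s : {s : Finset (Fin n) // (s.card : ℤ) = i}) :
    toTotal i ω s.1 = ω s := dif_pos s.2

theorem toTotal_of_card_ne (i : ℤ) (ω : drT k n M i) {s : Finset (Fin n)}
    (h : (s.card : ℤ) ≠ i) : toTotal i ω s = 0 := dif_neg h

theorem toTotal_injective (i : ℤ) :
    Function.Injective (toTotal (k := k) (n := n) (M := M) i) := by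
  intro ω ω' h
  funext s
  rw [← toTotal_coe i ω, h, toTotal_coe]

/-- The de Rham differential between terms of consecutive degrees `i` and `i'`. -/
noncomputable def drDOfEq (pd : Fin n → Module.End k M) {i i' : ℤ} (h : i + 1 = i') :
    drT k n M i →ₗ[k] drT k n M i' :=
  (LinearEquiv.funCongrLeft k M
    (Equiv.subtypeEquivRight fun s : Finset (Fin n) => by rw [h])).toLinearMap ∘ₗ drD pd i

theorem drDOfEq_rfl (pd : Fin n → Module.End k M) (i : ℤ) :
    drDOfEq pd (rfl : i + 1 = i + 1) = drD pd i := rfl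

theorem drBnd_eq_range (pd : Fin n → Module.End k M) (i : ℤ) :
    drBnd pd i = LinearMap.range (drDOfEq pd (sub_add_cancel i 1)) := by
  have key : ∀ (a b : ℤ) (h : a + 1 = b),
      (h ▸ LinearMap.range (drD pd a) : Submodule k (drT k n M b)) =
        LinearMap.range (drDOfEq pd h) := by
    intro a b h
    subst h
    rfl
  exact key _ _ _

theorem toTotal_drDOfEq (pd : Fin n → Module.End k M) {i i' : ℤ} (h : i + 1 = i')
    (ω : drT k n M i) : toTotal i' (drDOfEq pd h ω) = totalD pd (toTotal i ω) := by
  subst h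
  funext t
  rw [drDOfEq_rfl]
  by_cases ht : (t.card : ℤ) = i + 1
  · rw [toTotal_coe _ _ ⟨t, ht⟩, totalD, ← Finset.sum_attach]
    refine Finset.sum_congr rfl fun j _ => ?_
    rw [← toTotal_coe i ω]
  · rw [toTotal_of_card_ne _ _ ht, totalD]
    refine (Finset.sum_eq_zero fun j hj => ?_).symm
    rw [toTotal_of_card_ne, map_zero, smul_zero]
    have := Finset.card_erase_add_one hj
    omega

theorem card_filter_lt_erase_of_lt {t : Finset (Fin n)} {j l : Fin n} (hj : j ∈ t) (h : j < l) :
    ((t.erase j).filter (fun a => a < l)).card + 1 = (t.filter (fun a => a < l)).card := by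
  rw [Finset.filter_erase]
  exact Finset.card_erase_add_one (by simp [hj, h])

theorem filter_lt_erase_of_le {t : Finset (Fin n)} {j l : Fin n} (h : l ≤ j) :
    (t.erase j).filter (fun a => a < l) = t.filter (fun a => a < l) := by
  ext a
  simp only [Finset.mem_filter, Finset.mem_erase]
  constructor
  · rintro ⟨⟨-, h₁⟩, h₂⟩
    exact ⟨h₁, h₂⟩
  · rintro ⟨h₁, h₂⟩
    exact ⟨⟨(h₂.trans_le h).ne, h₁⟩, h₂⟩

theorem totalD_totalD (pd : Fin n → Module.End k M) (hcomm : ∀ i j, Commute (pd i) (pd j))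
    (ω : Finset (Fin n) → M) : totalD pd (totalD pd ω) = 0 := by
  funext t
  have hpair : ∀ j ∈ t, ∀ l ∈ t, j < l →
      (-1 : ℤ) ^ ((t.filter (fun a => a < j)).card) *
          (-1 : ℤ) ^ (((t.erase j).filter (fun a => a < l)).card) =
        -((-1 : ℤ) ^ ((t.filter (fun a => a < l)).card) *
          (-1 : ℤ) ^ (((t.erase l).filter (fun a => a < j)).card)) := by
    intro j hj l _ hjl
    rw [filter_lt_erase_of_le hjl.le, ← card_filter_lt_erase_of_lt hj hjl]
    ring
  simp only [totalD, map_sum, map_zsmul, Finset.smul_sum, smul_smul, Pi.zero_apply]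
  rw [Finset.sum_sigma']
  refine Finset.sum_involution (fun x _ => ⟨x.2, x.1⟩) ?_ ?_ ?_ ?_
  · rintro ⟨j, l⟩ hx
    simp only [Finset.mem_sigma, Finset.mem_erase] at hx
    obtain ⟨hj, hlj, hl⟩ := hx
    have hc : pd l (pd j (ω ((t.erase l).erase j))) = pd j (pd l (ω ((t.erase j).erase l))) := by
      rw [Finset.erase_right_comm]
      exact LinearMap.congr_fun (hcomm l j).eq _
    dsimp only
    rw [hc, ← add_smul]
    rcases lt_or_gt_of_ne hlj with h | h
    · rw [hpair l hl j hj h, add_neg_cancel, zero_smul]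
    · rw [hpair j hj l hl h, neg_add_cancel, zero_smul]
  · rintro ⟨j, l⟩ hx _ h
    simp only [Finset.mem_sigma, Finset.mem_erase] at hx
    simp only [Sigma.mk.injEq, heq_eq_eq] at h
    exact hx.2.1 h.1
  · rintro ⟨j, l⟩ hx
    simp only [Finset.mem_sigma, Finset.mem_erase] at hx ⊢
    exact ⟨hx.2.2, hx.2.1.symm, hx.1⟩
  · rintro ⟨j, l⟩ _
    rfl

theorem drDOfEq_drDOfEq (pd : Fin n → Module.End k M) (hcomm : ∀ i j, Commute (pd i) (pd j))
    {i i' i'' : ℤ} (h : i + 1 = i') (h' : i' + 1 = i'') (ω : drT k n M i) :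
    drDOfEq pd h' (drDOfEq pd h ω) = 0 := by
  apply toTotal_injective
  rw [toTotal_drDOfEq, toTotal_drDOfEq, totalD_totalD pd hcomm, map_zero]

/-- The map induced on the terms of the de Rham complexes by a linear map of coefficients. -/
def drMap (Q : M →ₗ[k] M) (i : ℤ) : drT k n M i →ₗ[k] drT k n M i :=
  Q.compLeft _

theorem drMap_apply (Q : M →ₗ[k] M) (i : ℤ) (ω : drT k n M i)
    (s : {s : Finset (Fin n) // (s.card : ℤ) = i}) : drMap Q i ω s = Q (ω s) := rfl

theorem drMap_drDOfEq (pd : Fin n → Module.End k M) {Q Q' : M →ₗ[k] M}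
    (hQ : ∀ j m, Q' (pd j m) = pd j (Q m)) {i i' : ℤ} (h : i + 1 = i') (ω : drT k n M i) :
    drMap Q' i' (drDOfEq pd h ω) = drDOfEq pd h (drMap Q i ω) := by
  subst h
  funext t
  rw [drMap_apply, drDOfEq_rfl]
  simp only [drD, LinearMap.coe_mk, AddHom.coe_mk, map_sum, map_zsmul, hQ, drMap_apply]

/-- The sign of the permutation of `Fin n` listing `s` before its complement, up to a global
sign depending on the cardinality of `s` only. -/
def complSign (s : Finset (Fin n)) : ℤ := (-1) ^ (∑ j ∈ s, (j : ℕ))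

theorem complSign_mul_self (s : Finset (Fin n)) : complSign s * complSign s = 1 := by
  rw [complSign, ← mul_pow]
  simp

theorem card_filter_lt_compl_erase {t : Finset (Fin n)} {j : Fin n} :
    ((t.erase j)ᶜ.filter (fun a => a < j)).card + (t.filter (fun a => a < j)).card = j := by
  rw [← filter_lt_erase_of_le (t := t) le_rfl, add_comm,
    ← Finset.card_union_of_disjoint, ← Finset.filter_union, Finset.union_compl]
  · rw [← Fin.card_Iio j]
    congr 1
    ext a
    simp
  · exact Finset.disjoint_filter_filter disjoint_compl_right

theorem complSign_erase_mul {t : Finset (Fin n)} {j : Fin n} (hj : j ∈ t) :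
    complSign (t.erase j) * (-1) ^ ((t.erase j)ᶜ.filter (fun a => a < j)).card =
      complSign t * (-1) ^ (t.filter (fun a => a < j)).card := by
  have h := card_filter_lt_compl_erase (t := t) (j := j)
  have hs : complSign t = (-1) ^ (j : ℕ) * complSign (t.erase j) := by
    rw [complSign, ← Finset.add_sum_erase t _ hj, pow_add, complSign]
  rw [hs, ← h, pow_add]
  have h2 : ((-1 : ℤ) ^ (t.filter (fun a => a < j)).card) *
      (-1) ^ (t.filter (fun a => a < j)).card = 1 := by
    rw [← mul_pow]
    simp
  linear_combination (-complSign (t.erase j) *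
    (-1) ^ ((t.erase j)ᶜ.filter (fun a => a < j)).card) * h2

/-- The total de Rham differentials are adjoint, up to sign, for the pairing induced by a
pairing of coefficients for which the operators are skew-adjoint. -/
theorem sum_totalD_pairing (pd : Fin n → Module.End k M) (pd' : Fin n → Module.End k N)
    (g : N →ₗ[k] Module.Dual k M) (hg : ∀ j x m, g (pd' j x) m = -g x (pd j m))
    (ξ : Finset (Fin n) → N) (ω : Finset (Fin n) → M) :
    ∑ s, complSign s • g (totalD pd' ξ sᶜ) (ω s) =
      -∑ t, complSign t • g (ξ tᶜ) (totalD pd ω t) := by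
  simp only [totalD, map_sum, map_zsmul, LinearMap.sum_apply, LinearMap.smul_apply, hg,
    Finset.smul_sum, smul_smul, smul_neg, Finset.sum_neg_distrib]
  rw [Finset.sum_sigma', Finset.sum_sigma', neg_inj]
  refine Finset.sum_nbij' (fun x => ⟨insert x.2 x.1, x.2⟩) (fun x => ⟨x.1.erase x.2, x.2⟩)
    ?_ ?_ ?_ ?_ ?_
  · rintro ⟨s, j⟩ _
    simp
  · rintro ⟨s, j⟩ _
    simp
  · rintro ⟨s, j⟩ h
    have hj : j ∉ s := by simpa using h
    simp [Finset.erase_insert hj]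
  · rintro ⟨s, j⟩ h
    have hj : j ∈ s := by simpa using h
    simp [Finset.insert_erase hj]
  · rintro ⟨s, j⟩ h
    have hj : j ∉ s := by simpa using h
    have he := complSign_erase_mul (Finset.mem_insert_self j s)
    rw [Finset.erase_insert hj] at he
    dsimp only
    rw [he, Finset.erase_insert hj, Finset.compl_insert]

/-- The pairing between the `b`-th term of the de Rham complex of `N` and the `a`-th term of the
de Rham complex of `M` induced by a pairing of coefficients. -/
noncomputable def drPairing (g : N →ₗ[k] Module.Dual k M) (b a : ℤ) :
    drT k n N b →ₗ[k] Module.Dual k (drT k n M a) :=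
  LinearMap.mk₂ k
    (fun ξ ω => ∑ s : Finset (Fin n), complSign s • g (toTotal b ξ sᶜ) (toTotal a ω s))
    (by intros; simp [Finset.sum_add_distrib])
    (by intros; simp [Finset.mul_sum, mul_left_comm])
    (by intros; simp [Finset.sum_add_distrib])
    (by intros; simp [Finset.mul_sum, mul_left_comm])

theorem drPairing_apply (g : N →ₗ[k] Module.Dual k M) (b a : ℤ) (ξ : drT k n N b)
    (ω : drT k n M a) : drPairing g b a ξ ω =
      ∑ s : Finset (Fin n), complSign s • g (toTotal b ξ sᶜ) (toTotal a ω s) := rfl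

theorem drPairing_drDOfEq (pd : Fin n → Module.End k M) (pd' : Fin n → Module.End k N)
    (g : N →ₗ[k] Module.Dual k M) (hg : ∀ j x m, g (pd' j x) m = -g x (pd j m))
    {b b' a a' : ℤ} (hb : b + 1 = b') (ha : a + 1 = a') (ξ : drT k n N b) (ω : drT k n M a) :
    drPairing g b' a (drDOfEq pd' hb ξ) ω = -drPairing g b a' ξ (drDOfEq pd ha ω) := by
  rw [drPairing_apply, drPairing_apply, toTotal_drDOfEq, toTotal_drDOfEq]
  exact sum_totalD_pairing pd pd' g hg _ _

theorem card_compl_eq {a b : ℤ} (h : a + b = n) {s : Finset (Fin n)} :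
    (sᶜ.card : ℤ) = b ↔ (s.card : ℤ) = a := by
  have := Finset.card_add_card_compl s
  rw [Fintype.card_fin] at this
  omega

theorem drPairing_single (g : N →ₗ[k] Module.Dual k M) {b a : ℤ} (ξ : drT k n N b)
    (s : {s : Finset (Fin n) // (s.card : ℤ) = a}) (m : M) :
    drPairing g b a ξ (Pi.single s m) = complSign s.1 • g (toTotal b ξ s.1ᶜ) m := by
  rw [drPairing_apply, Finset.sum_eq_single s.1]
  · rw [toTotal_coe, Pi.single_eq_same]
  · intro t _ hts
    by_cases ht : (t.card : ℤ) = a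
    · rw [toTotal_coe _ _ ⟨t, ht⟩, Pi.single_eq_of_ne, map_zero, smul_zero]
      exact fun h => hts (congrArg Subtype.val h)
    · rw [toTotal_of_card_ne _ _ ht, map_zero, smul_zero]
  · simp

theorem drPairing_injective (g : N →ₗ[k] Module.Dual k M) (hg : Function.Injective g)
    {b a : ℤ} (h : a + b = n) : Function.Injective (drPairing (n := n) g b a) := by
  rw [injective_iff_map_eq_zero]
  intro ξ hξ
  funext t
  have hcard : ((t.1ᶜ).card : ℤ) = a := (card_compl_eq (by omega)).mpr t.2
  refine hg (LinearMap.ext fun m => ?_)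
  have h₁ := drPairing_single g ξ ⟨t.1ᶜ, hcard⟩ m
  rw [hξ, compl_compl, toTotal_coe, LinearMap.zero_apply] at h₁
  have h₂ := congrArg (complSign (t.1ᶜ) • ·) h₁
  dsimp only at h₂
  rw [smul_smul, complSign_mul_self, one_smul, smul_zero] at h₂
  rw [← h₂]
  simp

theorem exists_drPairing_eq_comp (g : N →ₗ[k] Module.Dual k M) {b a : ℤ} (h : a + b = n)
    (Q : M →ₗ[k] M) (hQ : ∀ f : Module.Dual k M, ∃ x, g x = f ∘ₗ Q)
    (φ : Module.Dual k (drT k n M a)) : ∃ ξ, drPairing g b a ξ = φ ∘ₗ drMap Q a := by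
  choose x hx using hQ
  refine ⟨fun t => complSign (t.1ᶜ) • x (φ ∘ₗ LinearMap.single k (fun _ => M)
    ⟨t.1ᶜ, (card_compl_eq (by omega)).mpr t.2⟩), ?_⟩
  refine LinearMap.pi_ext fun s m => ?_
  have hs : ((s.1ᶜ).card : ℤ) = b := (card_compl_eq h).mpr s.2
  rw [drPairing_single, toTotal_coe _ _ ⟨s.1ᶜ, hs⟩]
  have hsingle : drMap Q a (Pi.single s m) = Pi.single s (Q m) := by
    funext t
    rw [drMap_apply]
    exact Pi.apply_single (fun _ => Q) (fun _ => map_zero Q) s m t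
  simp only [compl_compl, map_zsmul, LinearMap.smul_apply, smul_smul, complSign_mul_self,
    one_smul, hx, LinearMap.comp_apply, hsingle]
  rfl

theorem drPairing_comp_drMap (g : N →ₗ[k] Module.Dual k M) {b a : ℤ} (ξ : drT k n N b)
    (Q : M →ₗ[k] M) (hQ : ∀ t, g (ξ t) ∘ₗ Q = g (ξ t)) :
    drPairing g b a ξ ∘ₗ drMap Q a = drPairing g b a ξ := by
  refine LinearMap.ext fun ω => ?_
  rw [LinearMap.comp_apply, drPairing_apply, drPairing_apply]
  refine Finset.sum_congr rfl fun s _ => ?_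
  by_cases hs : (s.card : ℤ) = a
  · rw [toTotal_coe _ _ ⟨s, hs⟩, toTotal_coe _ _ ⟨s, hs⟩, drMap_apply]
    by_cases hs' : (sᶜ.card : ℤ) = b
    · rw [toTotal_coe _ _ ⟨sᶜ, hs'⟩, ← LinearMap.comp_apply, hQ]
    · rw [toTotal_of_card_ne _ _ hs', map_zero, LinearMap.zero_apply, LinearMap.zero_apply]
  · rw [toTotal_of_card_ne _ _ hs, toTotal_of_card_ne _ _ hs]

end Differential

section Grading

variable {k : Type} [Field k] {n : ℕ} {M : Type} [AddCommGroup M] [Module k M]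
  (deg : ℤ → Submodule k M) (hint : DirectSum.IsInternal deg)

theorem linearMap_ext_of_isInternal {deg : ℤ → Submodule k M} (hint : DirectSum.IsInternal deg)
    {V : Type} [AddCommGroup V] [Module k V] {f g : M →ₗ[k] V}
    (h : ∀ l, ∀ m ∈ deg l, f m = g m) : f = g := by
  refine LinearMap.ext fun m => ?_
  have hm : m ∈ ⨆ l, deg l := by
    rw [hint.submodule_iSup_eq_top]
    trivial
  induction hm using Submodule.iSup_induction' with
  | mem l m hm => exact h l m hm
  | zero => simp
  | add x y _ _ hx hy => rw [map_add, map_add, hx, hy]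

theorem coeLinearMap_symm_of_mem (l : ℤ) (m : M) (hm : m ∈ deg l) :
    (LinearEquiv.ofBijective (DirectSum.coeLinearMap deg) hint).symm m =
      DirectSum.lof k ℤ (fun j => ↥(deg j)) l ⟨m, hm⟩ := by
  rw [LinearEquiv.symm_apply_eq]
  exact (DirectSum.coeLinearMap_lof deg l ⟨m, hm⟩).symm

theorem gproj_of_mem (l : ℤ) (m : M) (hm : m ∈ deg l) : gproj deg hint l m = ⟨m, hm⟩ := by
  rw [gproj, LinearMap.comp_apply, LinearEquiv.coe_coe, coeLinearMap_symm_of_mem deg hint l m hm,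
    DirectSum.component.lof_self]

theorem gproj_of_mem_of_ne {l l' : ℤ} (h : l ≠ l') (m : M) (hm : m ∈ deg l) :
    gproj deg hint l' m = 0 := by
  rw [gproj, LinearMap.comp_apply, LinearEquiv.coe_coe, coeLinearMap_symm_of_mem deg hint l m hm,
    DirectSum.component.of, dif_neg h]

/-- The projection of `M` onto the sum of its components of degree in `T`. -/
noncomputable def degProj (T : Finset ℤ) : M →ₗ[k] M :=
  ∑ l ∈ T, (deg l).subtype ∘ₗ gproj deg hint l

theorem degProj_apply (T : Finset ℤ) (m : M) :
    degProj deg hint T m = ∑ l ∈ T, (gproj deg hint l m : M) := by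
  simp [degProj]

theorem degProj_of_mem (T : Finset ℤ) (l : ℤ) (m : M) (hm : m ∈ deg l) :
    degProj deg hint T m = if l ∈ T then m else 0 := by
  rw [degProj_apply]
  split_ifs with h
  · rw [Finset.sum_eq_single_of_mem l h, gproj_of_mem deg hint l m hm]
    intro l' _ hl'
    rw [gproj_of_mem_of_ne deg hint hl'.symm m hm, ZeroMemClass.coe_zero]
  · refine Finset.sum_eq_zero fun l' hl' => ?_
    rw [gproj_of_mem_of_ne deg hint (fun e => h (by rwa [e])) m hm, ZeroMemClass.coe_zero]

theorem exists_degProj_eq_self (m : M) : ∃ T₀, ∀ T, T₀ ≤ T → degProj deg hint T m = m := by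
  have hm : m ∈ ⨆ l, deg l := by
    rw [hint.submodule_iSup_eq_top]
    trivial
  induction hm using Submodule.iSup_induction' with
  | mem l m hm =>
    refine ⟨{l}, fun T hT => ?_⟩
    rw [degProj_of_mem deg hint T l m hm, if_pos (hT (Finset.mem_singleton_self l))]
  | zero => exact ⟨∅, fun T _ => map_zero _⟩
  | add x y _ _ hx hy =>
    obtain ⟨T₁, h₁⟩ := hx
    obtain ⟨T₂, h₂⟩ := hy
    refine ⟨T₁ ⊔ T₂, fun T hT => ?_⟩
    rw [map_add, h₁ T (le_sup_left.trans hT), h₂ T (le_sup_right.trans hT)]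

theorem degProj_pd (p : Module.End k M) (hp : ∀ l, ∀ m ∈ deg l, p m ∈ deg (l - 1))
    {T T' : Finset ℤ} (hT : ∀ l, l - 1 ∈ T' ↔ l ∈ T) (m : M) :
    degProj deg hint T' (p m) = p (degProj deg hint T m) := by
  have : degProj deg hint T' ∘ₗ p = p ∘ₗ degProj deg hint T := by
    refine linearMap_ext_of_isInternal hint fun l m hm => ?_
    rw [LinearMap.comp_apply, LinearMap.comp_apply, degProj_of_mem deg hint T l m hm,
      degProj_of_mem deg hint T' (l - 1) _ (hp l m hm)]
    by_cases h : l ∈ T <;> simp [h, hT]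
  exact LinearMap.congr_fun this m

theorem gev_lof (l : ℤ) (f : Module.Dual k ↥(deg (-l - (n : ℤ)))) (m : M) :
    gev (n := n) deg hint
      (DirectSum.lof k ℤ (fun l => Module.Dual k ↥(deg (-l - (n : ℤ)))) l f) m =
        f (gproj deg hint (-l - (n : ℤ)) m) := by
  rw [gev]
  erw [DirectSum.toModule_lof]
  rfl

theorem gev_apply_of_mem (lam : DDcar deg n) (l : ℤ) (m : M) (hm : m ∈ deg (-l - (n : ℤ))) :
    gev deg hint lam m = lam l ⟨m, hm⟩ := by
  induction lam using DirectSum.induction_on with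
  | zero => simp
  | of l' f =>
    have h := gev_lof deg hint l' f m
    by_cases hl : l' = l
    · subst hl
      rw [gproj_of_mem deg hint _ m hm] at h
      refine h.trans ?_
      rw [DirectSum.of_eq_same]
    · rw [gproj_of_mem_of_ne deg hint (by omega) m hm, map_zero] at h
      refine h.trans ?_
      rw [DirectSum.of_eq_of_ne _ _ _ (Ne.symm hl), LinearMap.zero_apply]
  | add x y hx hy => rw [map_add, LinearMap.add_apply, hx, hy, DirectSum.add_apply,
      LinearMap.add_apply]

theorem gev_injective : Function.Injective (gev (n := n) deg hint) := by
  rw [injective_iff_map_eq_zero]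
  intro lam h
  refine DFinsupp.ext fun l => LinearMap.ext fun m => ?_
  have := gev_apply_of_mem deg hint lam l m.1 m.2
  rw [h] at this
  exact this.symm

theorem exists_gev_eq_comp_degProj (T : Finset ℤ) (f : Module.Dual k M) :
    ∃ lam : DDcar deg n, gev deg hint lam = f ∘ₗ degProj deg hint T := by
  refine ⟨∑ l ∈ T, DirectSum.lof k ℤ (fun l => Module.Dual k ↥(deg (-l - (n : ℤ))))
    (-l - n) (f ∘ₗ (deg _).subtype), LinearMap.ext fun m => ?_⟩
  rw [map_sum, LinearMap.sum_apply, LinearMap.comp_apply, degProj_apply, map_sum]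
  refine Finset.sum_congr rfl fun l _ => ?_
  rw [gev_lof, LinearMap.comp_apply, Submodule.subtype_apply]
  rw [show -(-l - (n : ℤ)) - n = l by ring]

theorem exists_gev_comp_degProj_eq (lam : DDcar deg n) :
    ∃ T₀, ∀ T, T₀ ≤ T → gev deg hint lam ∘ₗ degProj deg hint T = gev deg hint lam := by
  induction lam using DirectSum.induction_on with
  | zero => exact ⟨∅, fun T _ => by simp⟩
  | of l f =>
    refine ⟨{-l - (n : ℤ)}, fun T hT => linearMap_ext_of_isInternal hint fun l' m hm => ?_⟩
    rw [LinearMap.comp_apply, degProj_of_mem deg hint T l' m hm]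
    split_ifs with h
    · rfl
    · rw [map_zero]
      have hl' : l' ≠ -l - (n : ℤ) := fun e => h (e ▸ hT (Finset.mem_singleton_self _))
      refine ((gev_lof deg hint l f m).trans ?_).symm
      rw [gproj_of_mem_of_ne deg hint hl' m hm, map_zero]
  | add x y hx hy =>
    obtain ⟨T₁, h₁⟩ := hx
    obtain ⟨T₂, h₂⟩ := hy
    refine ⟨T₁ ⊔ T₂, fun T hT => ?_⟩
    rw [map_add, LinearMap.add_comp, h₁ T (le_sup_left.trans hT), h₂ T (le_sup_right.trans hT)]

end Grading

/-- Let `M` be a graded `D`-module over `R = k[x₁,…,xₙ]` (`char k = 0`,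
`n ≥ 1`), with commuting `∂`-operators `pd i` satisfying the Leibniz rule and compatible
with the internal grading `deg`.  Let `Dpd` be the `∂`-operators of the graded Matlis dual
`DD(M)` (characterized by `⟨∂_i·λ, m⟩ = -⟨λ, ∂_i m⟩`).  If `H^i_dR(M)` is finite
dimensional for some `0 ≤ i ≤ n`, then `H^{n-i}_dR(DD(M))` is isomorphic to the `k`-linear
dual of `H^i_dR(M)`; in particular they have the same dimension. -/
theorem duality_for_deRham_cohomology_of_graded_Matlis_dual
    {k : Type} [Field k] [CharZero k] {n : ℕ} (hn : 0 < n)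
    {M : Type} [AddCommGroup M] [Module k M]
    [Module (MvPolynomial (Fin n) k) M] [IsScalarTower k (MvPolynomial (Fin n) k) M]
    (pd : Fin n → Module.End k M)
    (hcomm : ∀ i j, Commute (pd i) (pd j))
    (hleib : ∀ (i : Fin n) (f : MvPolynomial (Fin n) k) (m : M),
      pd i (f • m) = (pderiv i f) • m + f • (pd i m))
    (deg : ℤ → Submodule k M)
    (hint : DirectSum.IsInternal deg)
    (hsmul : ∀ (d : ℕ) (f : MvPolynomial (Fin n) k), f.IsHomogeneous d →
      ∀ (l : ℤ), ∀ m ∈ deg l, f • m ∈ deg (l + d))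
    (hpd : ∀ (i : Fin n) (l : ℤ), ∀ m ∈ deg l, pd i m ∈ deg (l - 1))
    (Dpd : Fin n → Module.End k (DDcar deg n))
    (hDpd : ∀ (i : Fin n) (lam : DDcar deg n) (m : M),
      gev deg hint (Dpd i lam) m = - gev deg hint lam (pd i m))
    (i : ℕ) (hi : i ≤ n)
    (hfin : FiniteDimensional k (drH (k := k) (n := n) (M := M) pd (i : ℤ))) :
    Nonempty (drH (k := k) (n := n) (M := DDcar deg n) Dpd ((n : ℤ) - (i : ℤ)) ≃ₗ[k] Module.Dual k (drH (k := k) (n := n) (M := M) pd (i : ℤ))) ∧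
      Module.finrank k (drH (k := k) (n := n) (M := DDcar deg n) Dpd ((n : ℤ) - (i : ℤ))) = Module.finrank k (drH (k := k) (n := n) (M := M) pd (i : ℤ)) := by
  have hequiv : Nonempty (drH (k := k) (n := n) (M := DDcar deg n) Dpd ((n : ℤ) - (i : ℤ)) ≃ₗ[k]
      Module.Dual k (drH (k := k) (n := n) (M := M) pd (i : ℤ))) := by
    have hgev := gev_injective (n := n) deg hint
    refine nonempty_cohomology_equiv_dual (ι := Finset ℤ)
      (drDOfEq pd (sub_add_cancel (i : ℤ) 1)) (drD pd (i : ℤ))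
      (drDOfEq_drDOfEq pd hcomm _ rfl)
      (drDOfEq Dpd (sub_add_cancel ((n : ℤ) - (i : ℤ)) 1)) (drD Dpd ((n : ℤ) - (i : ℤ)))
      (drPairing (gev deg hint) _ _) (drPairing (gev deg hint) _ _)
      (drPairing (gev deg hint) _ _)
      (drPairing_injective _ hgev (by ring)) (drPairing_injective _ hgev (by ring))
      (fun b a => drPairing_drDOfEq pd Dpd _ hDpd _ rfl b a)
      (fun b a => drPairing_drDOfEq pd Dpd _ hDpd rfl _ b a)
      (fun T => drMap (degProj deg hint (T.image (· + 1))) _)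
      (fun T => drMap (degProj deg hint T) _)
      (fun T => drMap (degProj deg hint (T.image (· - 1))) _)
      (fun T a => drMap_drDOfEq pd (fun j m => degProj_pd deg hint _ (hpd j) ?_ m) _ a)
      (fun T a => drMap_drDOfEq pd (fun j m => degProj_pd deg hint _ (hpd j) ?_ m) rfl a)
      (fun T φ => exists_drPairing_eq_comp _ (by ring) _
        (exists_gev_eq_comp_degProj deg hint T) φ)
      (fun T φ => exists_drPairing_eq_comp _ (by ring) _
        (exists_gev_eq_comp_degProj deg hint _) φ)
      (fun b => ?_) (fun a => ?_) _ (drBnd_eq_range pd _) _ (drBnd_eq_range Dpd _)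
    · intro l
      simp only [Finset.mem_image]
      exact ⟨fun h => ⟨_, h, by ring⟩, fun ⟨x, hx, he⟩ => by rwa [← he, add_sub_cancel_right]⟩
    · intro l
      simp
    · choose T hT using exists_gev_comp_degProj_eq (n := n) deg hint
      exact ⟨Finset.univ.sup fun t => T (b t), drPairing_comp_drMap _ b _ fun t =>
        hT _ _ (Finset.le_sup (f := fun t => T (b t)) (Finset.mem_univ t))⟩
    · choose T hT using exists_degProj_eq_self deg hint
      exact ⟨Finset.univ.sup fun s => T (a s), fun T' hT' => funext fun s =>
        hT _ _ ((Finset.le_sup (f := fun s => T (a s)) (Finset.mem_univ s)).trans hT')⟩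
  obtain ⟨e⟩ := hequiv
  exact ⟨⟨e⟩, e.finrank_eq.trans Subspace.dual_finrank_eq⟩
end

section
/- Let M be a D-module over R = k[x_1,…,x_n] such that H^0_dR(M) = ⋂_{i=1}^n ker ∂_i^M is a finite-dimensional k-vector space. Then dim_k H^0_dR(M) equals the greatest integer s ≥ 0 for which there exists an injective D-linear homomorphism R^s → M, where R^s is the free R-module of rank s on which ∂_i acts componentwise as the formal partial derivative ∂/∂x_i. -/
/-!
Statement 3: For a `D`-module `M` over `R = k[x₁,…,xₙ]` with `H^0_dR(M) = ⋂ ker ∂_i`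
finite dimensional, `dim_k H^0_dR(M)` is the greatest `s` such that there is an injective
`D`-linear map `R^s → M`.
-/

open MvPolynomial

theorem MvPolynomial.eq_C_of_pderiv_eq_zero {k σ : Type*} [Field k] [CharZero k]
    {p : MvPolynomial σ k} (hp : ∀ i, pderiv i p = 0) : p = C (coeff 0 p) := by
  classical
  ext m
  rw [coeff_C]
  split_ifs with hm
  · rw [hm]
  · obtain ⟨i, hi⟩ : ∃ i, m i ≠ 0 := by
      by_contra! h
      exact hm (Finsupp.ext h).symm
    have hle : Finsupp.single i 1 ≤ m := by
      simpa [Finsupp.single_le_iff] using Nat.one_le_iff_ne_zero.mpr hi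
    have h := coeff_pderiv (i := i) p (m - Finsupp.single i 1)
    rw [hp i, coeff_zero, tsub_add_cancel_of_le hle] at h
    exact (mul_eq_zero.mp h.symm).resolve_right (Nat.cast_add_one_ne_zero _)

/-- Horizontal vectors that are linearly independent over the field of constants are linearly
independent over the polynomial ring. -/
theorem LinearIndependent.mvPolynomial_of_horizontal {k σ ι M : Type*} [Field k] [CharZero k]
    [AddCommGroup M] [Module k M] [Module (MvPolynomial σ k) M]
    [IsScalarTower k (MvPolynomial σ k) M] [Fintype ι] (pd : σ → Module.End k M)
    (hleib : ∀ (i : σ) (f : MvPolynomial σ k) (m : M),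
      pd i (f • m) = (pderiv i f) • m + f • (pd i m))
    {b : ι → M} (hb : LinearIndependent k b) (hpd : ∀ i j, pd i (b j) = 0) :
    LinearIndependent (MvPolynomial σ k) b := by
  have key : ∀ (N : ℕ) (v : ι → MvPolynomial σ k),
      (∀ j m, N ≤ m.degree → coeff m (v j) = 0) → ∑ j, v j • b j = 0 → ∀ j, v j = 0 := by
    intro N
    induction N with
    | zero => exact fun v hv _ j => MvPolynomial.ext _ _ fun m => hv j m (Nat.zero_le _)
    | succ N ih =>
      intro v hv hsum
      have hconst : ∀ j, v j = C (coeff 0 (v j)) := fun j =>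
        MvPolynomial.eq_C_of_pderiv_eq_zero fun i => by
          refine ih (fun j => pderiv i (v j)) (fun j m hm => ?_) ?_ j
          · rw [coeff_pderiv, hv j _ (by simpa using hm), zero_mul]
          · simpa [hleib, hpd] using congrArg (pd i) hsum
      have hsum' : ∑ j, coeff 0 (v j) • b j = 0 := by
        rw [← hsum]
        refine Finset.sum_congr rfl fun j _ => ?_
        conv_rhs => rw [hconst j, ← algebraMap_eq, algebraMap_smul]
      intro j
      rw [hconst j, Fintype.linearIndependent_iff.mp hb _ hsum' j, C_0]
  refine Fintype.linearIndependent_iff.mpr fun v hv => ?_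
  refine key (Finset.univ.sup (fun j => (v j).totalDegree) + 1) v (fun j m hm => ?_) hv
  refine coeff_eq_zero_of_totalDegree_lt ?_
  exact (Finset.le_sup (f := fun j => (v j).totalDegree) (Finset.mem_univ j)).trans_lt hm

theorem dim_H0_eq_greatest_rank_of_injective_Dlinear_map_from_free
    {k : Type} [Field k] [CharZero k] {n : ℕ} (hn : 0 < n)
    {M : Type} [AddCommGroup M] [Module k M]
    [Module (MvPolynomial (Fin n) k) M] [IsScalarTower k (MvPolynomial (Fin n) k) M]
    (pd : Fin n → Module.End k M)
    (hcomm : ∀ i j, Commute (pd i) (pd j))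
    (hleib : ∀ (i : Fin n) (f : MvPolynomial (Fin n) k) (m : M),
      pd i (f • m) = (pderiv i f) • m + f • (pd i m))
    (hfin : FiniteDimensional k ↥(⨅ i : Fin n, LinearMap.ker (pd i))) :
    IsGreatest
      {s : ℕ | ∃ φ : (Fin s → MvPolynomial (Fin n) k) →ₗ[MvPolynomial (Fin n) k] M,
        Function.Injective φ ∧
        ∀ (i : Fin n) (v : Fin s → MvPolynomial (Fin n) k),
          φ (fun j => pderiv i (v j)) = pd i (φ v)}
      (Module.finrank k ↥(⨅ i : Fin n, LinearMap.ker (pd i))) := by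
  constructor
  · let b := Module.finBasis k ↥(⨅ i : Fin n, LinearMap.ker (pd i))
    have hpd : ∀ i j, pd i (b j : M) = 0 := fun i j =>
      (Submodule.mem_iInf _).mp (b j).2 i
    have hb : LinearIndependent k fun j => (b j : M) :=
      b.linearIndependent.map' (Submodule.subtype _) (Submodule.ker_subtype _)
    refine ⟨Fintype.linearCombination _ fun j => (b j : M), ?_, fun i v => ?_⟩
    · exact linearIndependent_iff_injective_fintypeLinearCombination.mp
        (hb.mvPolynomial_of_horizontal pd hleib hpd)
    · simp [Fintype.linearCombination_apply, hleib, hpd]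
  · rintro s ⟨φ, hφ, hD⟩
    have hmem : ∀ j, φ (Pi.single j 1) ∈ ⨅ i : Fin n, LinearMap.ker (pd i) := fun j => by
      refine (Submodule.mem_iInf _).mpr fun i => ?_
      rw [LinearMap.mem_ker, ← hD, ← map_zero φ]
      congr 1
      ext1 l
      by_cases h : l = j
      · subst h; simp
      · simp [h]
    have hR : LinearIndependent (MvPolynomial (Fin n) k)
        fun j : Fin s => φ (Pi.single j 1) := by
      simpa [Function.comp_def] using
        (Pi.basisFun (MvPolynomial (Fin n) k) (Fin s)).linearIndependent.map' φ
          (LinearMap.ker_eq_bot.mpr hφ)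
    have hk : LinearIndependent k fun j : Fin s => φ (Pi.single j 1) :=
      hR.restrict_scalars' k
    have hH : LinearIndependent k
        fun j => (⟨φ (Pi.single j 1), hmem j⟩ : ↥(⨅ i : Fin n, LinearMap.ker (pd i))) :=
      LinearIndependent.of_comp (Submodule.subtype _) hk
    simpa using hH.fintype_card_le_finrank
end
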